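/- arXiv:0908.0477 — 3 statements merged into one kernel-verified Lean document; each statement's English description precedes it below -/
import Mathlib

section
/- If S = (s_1, s_2, …) is a sequence of integers each ≥ 2 and s_1 is even, then the S-adic odometer (Z̃(S), +1̃) can be embedded in (X_glider, T̃), the gliders-with-reflecting-walls cellular automaton. -/
instance (n : ℕ) : TopologicalSpace (ZMod n) := ⊥
instance (n : ℕ) : DiscreteTopology (ZMod n) := ⟨rfl⟩

/-- `odProd S k = s₁ s₂ ⋯ s_{k+1}` (where `S i = s_{i+1}`, i.e. `S 0 = s₁`). -/
def odProd (S : ℕ → ℕ) (k : ℕ) : ℕ := ∏ i ∈ Finset.range (k + 1), S i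

theorem odProd_dvd (S : ℕ → ℕ) (k : ℕ) : odProd S k ∣ odProd S (k + 1) := by
  have h : odProd S (k + 1) = odProd S k * S (k + 1) := Finset.prod_range_succ S (k + 1)
  rw [h]
  exact dvd_mul_right _ _

/-- `Z̃(S)`: the inverse limit of the cyclic groups `ℤ/(s₁⋯s_k)ℤ` under the
binding maps `z ↦ z mod s₁⋯s_k`, with its profinite (subspace-of-product)
topology. -/
def OdometerSpace (S : ℕ → ℕ) : Type :=
  { z : (k : ℕ) → ZMod (odProd S k) //
      ∀ k, ZMod.castHom (odProd_dvd S k) (ZMod (odProd S k)) (z (k + 1)) = z k }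

instance (S : ℕ → ℕ) : TopologicalSpace (OdometerSpace S) :=
  inferInstanceAs (TopologicalSpace
    { z : (k : ℕ) → ZMod (odProd S k) //
        ∀ k, ZMod.castHom (odProd_dvd S k) (ZMod (odProd S k)) (z (k + 1)) = z k })

/-- The `+1̃` map on the odometer: add `1` in every coordinate. -/
def odometerAddOne (S : ℕ → ℕ) (z : OdometerSpace S) : OdometerSpace S :=
  ⟨fun k => z.1 k + 1, fun k => by rw [map_add, map_one, z.2 k]⟩

/-- The alphabet `{W, L, R, ∅}` of the gliders-with-reflecting-walls CA
(`E` denotes the empty cell `∅`). -/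
inductive GSym : Type
  | W : GSym
  | L : GSym
  | R : GSym
  | E : GSym
  deriving DecidableEq

instance : TopologicalSpace GSym := ⊥
instance : DiscreteTopology GSym := ⟨rfl⟩

/-- The gliders-with-reflecting-walls map `T̃` (cells indexed by ℕ, cell 0
being the leftmost cell): walls do not move; an `L` with `∅` immediately to
its left swaps places with it, and an `L` with `W` immediately to its left
becomes `R` without moving; an `R` with `∅` immediately to its right swaps
places with it, and an `R` with `W` immediately to its right becomes `L`
without moving. -/
def gliderStep (x : ℕ → GSym) : ℕ → GSym := fun i =>
  match x i with
  | GSym.W => GSym.W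
  | GSym.L => if x (i - 1) = GSym.W then GSym.R else GSym.E
  | GSym.R => if x (i + 1) = GSym.W then GSym.L else GSym.E
  | GSym.E =>
      if x (i + 1) = GSym.L then GSym.L
      else if x (i - 1) = GSym.R then GSym.R
      else GSym.E

/-- The glider state space `X_glider`: the first cell is a wall, there are
infinitely many walls, and strictly between any two consecutive walls there is
exactly one particle (`L` or `R`), all other cells there being empty. -/
def XGlider : Set (ℕ → GSym) :=
  { x | x 0 = GSym.W ∧ (∀ N : ℕ, ∃ i, N ≤ i ∧ x i = GSym.W) ∧
      ∀ i j : ℕ, i < j → x i = GSym.W → x j = GSym.W →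
        (∀ k, i < k → k < j → x k ≠ GSym.W) →
        ∃! k, i < k ∧ k < j ∧ (x k = GSym.L ∨ x k = GSym.R) }

/-- The contents of cell `j ≤ n` of a block consisting of a wall (at `j = 0`) followed by `n`
non-wall cells, when its particle is in phase `v < 2 * n`: phases `v < n` are right movers in cell
`v + 1`, phases `n ≤ v` are left movers in cell `2 * n - v`. -/
def blockCell (n v j : ℕ) : GSym :=
  if j = 0 then GSym.W else if v < n ∧ j = v + 1 then GSym.R
  else if n ≤ v ∧ j + v = 2 * n then GSym.L else GSym.E

/-- The position of the wall opening the `k`-th block, where block `k` has `n k` non-wall cells. -/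
def wallPos (n : ℕ → ℕ) (k : ℕ) : ℕ := ∑ i ∈ Finset.range k, (n i + 1)

theorem wallPos_succ (n : ℕ → ℕ) (k : ℕ) : wallPos n (k + 1) = wallPos n k + (n k + 1) :=
  Finset.sum_range_succ _ _

theorem wallPos_strictMono (n : ℕ → ℕ) : StrictMono (wallPos n) :=
  strictMono_nat_of_lt_succ fun k => by rw [wallPos_succ]; omega

/-- The index of the block containing cell `i`. -/
def blockIndex (n : ℕ → ℕ) (i : ℕ) : ℕ := Nat.findGreatest (fun k => wallPos n k ≤ i) i

theorem blockIndex_wallPos_add (n : ℕ → ℕ) {k j : ℕ} (hj : j ≤ n k) :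
    blockIndex n (wallPos n k + j) = k := by
  rw [blockIndex, Nat.findGreatest_eq_iff]
  refine ⟨(wallPos_strictMono n).le_apply.trans (Nat.le_add_right _ _), fun _ => by omega, ?_⟩
  intro m hm _ h
  have := (wallPos_strictMono n).monotone (Nat.succ_le_of_lt hm)
  rw [Nat.succ_eq_add_one, wallPos_succ] at this
  omega

theorem exists_eq_wallPos_add (n : ℕ → ℕ) (i : ℕ) : ∃ k j, j ≤ n k ∧ i = wallPos n k + j := by
  induction i with
  | zero => exact ⟨0, 0, Nat.zero_le _, rfl⟩
  | succ i ih =>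
    obtain ⟨k, j, hj, rfl⟩ := ih
    rcases hj.lt_or_eq with h | h
    · exact ⟨k, j + 1, h, rfl⟩
    · exact ⟨k + 1, 0, Nat.zero_le _, by rw [wallPos_succ]; omega⟩

/-- The configuration whose `k`-th block has `n k` non-wall cells and a particle in phase `v k`. -/
def gliderConfig (n v : ℕ → ℕ) (i : ℕ) : GSym :=
  blockCell (n (blockIndex n i)) (v (blockIndex n i)) (i - wallPos n (blockIndex n i))

theorem gliderConfig_wallPos_add (n v : ℕ → ℕ) {k j : ℕ} (hj : j ≤ n k) :
    gliderConfig n v (wallPos n k + j) = blockCell (n k) (v k) j := by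
  rw [gliderConfig, blockIndex_wallPos_add n hj, Nat.add_sub_cancel_left]

theorem gliderConfig_wallPos (n v : ℕ → ℕ) (k : ℕ) :
    gliderConfig n v (wallPos n k) = GSym.W :=
  gliderConfig_wallPos_add n v (Nat.zero_le (n k))

theorem blockCell_eq_W {n v j : ℕ} : blockCell n v j = GSym.W ↔ j = 0 := by
  unfold blockCell; split_ifs <;> simp_all

theorem gliderConfig_eq_W {n v : ℕ → ℕ} {i : ℕ} :
    gliderConfig n v i = GSym.W ↔ ∃ k, i = wallPos n k := by
  constructor
  · intro h
    obtain ⟨k, j, hj, rfl⟩ := exists_eq_wallPos_add n i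
    rw [gliderConfig_wallPos_add n v hj, blockCell_eq_W] at h
    exact ⟨k, by rw [h, add_zero]⟩
  · rintro ⟨k, rfl⟩
    exact gliderConfig_wallPos n v k

theorem blockCell_eq_L_or_R {n v j : ℕ} :
    blockCell n v j = GSym.L ∨ blockCell n v j = GSym.R ↔
      j ≠ 0 ∧ ((v < n ∧ j = v + 1) ∨ (n ≤ v ∧ j + v = 2 * n)) := by
  unfold blockCell; split_ifs <;> simp_all

theorem gliderConfig_mem_XGlider {n v : ℕ → ℕ} (hv : ∀ k, v k < 2 * n k) :
    gliderConfig n v ∈ XGlider := by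
  have hmono := wallPos_strictMono n
  refine ⟨gliderConfig_wallPos n v 0,
    fun N => ⟨_, hmono.le_apply, gliderConfig_wallPos n v N⟩, ?_⟩
  intro i j hij hi hj hbetween
  obtain ⟨k, rfl⟩ := gliderConfig_eq_W.1 hi
  obtain ⟨l, rfl⟩ := gliderConfig_eq_W.1 hj
  have hkl : k < l := hmono.lt_iff_lt.1 hij
  have hl : l = k + 1 := by
    by_contra hne
    exact hbetween (wallPos n (k + 1)) (hmono (Nat.lt_succ_self k)) (hmono (by omega))
      (gliderConfig_wallPos n v _)
  subst hl
  have hvk := hv k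
  have hsucc := wallPos_succ n k
  have key : ∀ a, a ≤ n k → (gliderConfig n v (wallPos n k + a) = GSym.L ∨
      gliderConfig n v (wallPos n k + a) = GSym.R ↔
      a ≠ 0 ∧ ((v k < n k ∧ a = v k + 1) ∨ (n k ≤ v k ∧ a + v k = 2 * n k))) := fun a ha => by
    rw [gliderConfig_wallPos_add n v ha, blockCell_eq_L_or_R]
  obtain ⟨a, ha, ha0, hav⟩ : ∃ a, a ≤ n k ∧ a ≠ 0 ∧
      ((v k < n k ∧ a = v k + 1) ∨ (n k ≤ v k ∧ a + v k = 2 * n k)) := by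
    rcases lt_or_ge (v k) (n k) with h | h
    · exact ⟨v k + 1, by omega, by omega, by omega⟩
    · exact ⟨2 * n k - v k, by omega, by omega, by omega⟩
  refine ⟨wallPos n k + a, ⟨by omega, by omega, (key a ha).2 ⟨ha0, hav⟩⟩, ?_⟩
  rintro m ⟨h1, h2, h3⟩
  obtain ⟨b, rfl⟩ := Nat.exists_eq_add_of_le h1.le
  have := (key b (by omega)).1 h3
  omega

theorem gliderStep_gliderConfig {n v v' : ℕ → ℕ} (hv : ∀ k, v k < 2 * n k)
    (hv' : ∀ k, v' k = if v k + 1 = 2 * n k then 0 else v k + 1) :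
    gliderStep (gliderConfig n v) = gliderConfig n v' := by
  funext i
  obtain ⟨k, j, hj, rfl⟩ := exists_eq_wallPos_add n i
  rw [gliderConfig_wallPos_add n v' hj]
  have hvk := hv k
  rcases Nat.eq_zero_or_pos j with rfl | hj0
  · simp [gliderStep, gliderConfig_wallPos, blockCell]
  have hleft : gliderConfig n v (wallPos n k + j - 1) = blockCell (n k) (v k) (j - 1) := by
    rw [Nat.add_sub_assoc hj0, gliderConfig_wallPos_add n v (by omega)]
  have hright : gliderConfig n v (wallPos n k + j + 1) =
      if j = n k then GSym.W else blockCell (n k) (v k) (j + 1) := by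
    split_ifs with h
    · rw [h, add_assoc, ← wallPos_succ, gliderConfig_wallPos]
    · rw [add_assoc, gliderConfig_wallPos_add n v (by omega)]
  simp only [gliderStep, hleft, hright, gliderConfig_wallPos_add n v hj, hv']
  generalize n k = N at *
  generalize v k = V at *
  clear hleft hright hv hv'
  by_cases hR : V < N ∧ j = V + 1
  · have hc : blockCell N V j = GSym.R := by grind [blockCell]
    rw [hc]
    grind [blockCell]
  by_cases hL : N ≤ V ∧ j + V = 2 * N
  · have hc : blockCell N V j = GSym.L := by grind [blockCell]
    rw [hc]
    grind [blockCell]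
  have hc : blockCell N V j = GSym.E := by grind [blockCell]
  rw [hc]
  grind (splits := 20) [blockCell]

theorem blockCell_phase_injective {n v v' : ℕ} (hv : v < 2 * n)
    (h : ∀ j ≤ n, blockCell n v j = blockCell n v' j) : v = v' := by
  rcases lt_or_ge v n with hn | hn
  · have := h (v + 1) (by omega)
    grind [blockCell]
  · have := h (2 * n - v) (by omega)
    grind [blockCell]

theorem gliderConfig_injOn (n : ℕ → ℕ) :
    Set.InjOn (gliderConfig n) {v | ∀ k, v k < 2 * n k} := by
  intro v hv v' _ h
  funext k
  refine blockCell_phase_injective (hv k) fun j hj => ?_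
  rw [← gliderConfig_wallPos_add n v hj, h, gliderConfig_wallPos_add n v' hj]

theorem odProd_pos {S : ℕ → ℕ} (hS : ∀ k, 2 ≤ S k) (k : ℕ) : 0 < odProd S k :=
  Finset.prod_pos fun i _ => by have := hS i; omega

theorem even_odProd {S : ℕ → ℕ} (heven : Even (S 0)) (k : ℕ) : Even (odProd S k) :=
  heven.trans_dvd (Finset.dvd_prod_of_mem S (by simp))

theorem compactSpace_odometerSpace {S : ℕ → ℕ} (hS : ∀ k, 2 ≤ S k) :
    CompactSpace (OdometerSpace S) := by
  have (k : ℕ) : NeZero (odProd S k) := ⟨(odProd_pos hS k).ne'⟩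
  have hclosed : IsClosed {z : (k : ℕ) → ZMod (odProd S k) |
      ∀ k, ZMod.castHom (odProd_dvd S k) (ZMod (odProd S k)) (z (k + 1)) = z k} := by
    rw [Set.ofPred_forall]
    exact isClosed_iInter fun k => isClosed_eq
      (continuous_of_discreteTopology.comp (continuous_apply (k + 1))) (continuous_apply k)
  exact isCompact_iff_compactSpace.1 hclosed.isCompact

theorem continuous_odometerSpace_apply (S : ℕ → ℕ) (k : ℕ) :
    Continuous fun z : OdometerSpace S => z.1 k :=
  (continuous_apply k).comp continuous_subtype_val

/-- If `s₁` is even (here `S 0 = s₁`), the `S`-adic odometer can be embedded in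
`(X_glider, T̃)`, the gliders-with-reflecting-walls cellular automaton. -/
theorem odometer_embeds_in_glider_of_even_first (S : ℕ → ℕ) (hS : ∀ k, 2 ≤ S k)
    (heven : Even (S 0)) :
    ∃ Y : Set (ℕ → GSym), Y ⊆ XGlider ∧ IsClosed Y ∧
      Set.MapsTo gliderStep Y Y ∧
      ∃ h : OdometerSpace S ≃ₜ Y,
        ∀ z, (h (odometerAddOne S z) : ℕ → GSym) = gliderStep (h z) := by
  have hne (k : ℕ) : NeZero (odProd S k) := ⟨(odProd_pos hS k).ne'⟩
  have := compactSpace_odometerSpace hS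
  let n : ℕ → ℕ := fun k => odProd S k / 2
  have hn (k : ℕ) : 2 * n k = odProd S k := Nat.two_mul_div_two_of_even (even_odProd heven k)
  let phase : OdometerSpace S → ℕ → ℕ := fun z k => (z.1 k).val
  have hphase (z : OdometerSpace S) (k : ℕ) : phase z k < 2 * n k := by
    rw [hn]; exact ZMod.val_lt _
  let f : OdometerSpace S → ℕ → GSym := fun z => gliderConfig n (phase z)
  have hcont : Continuous f := continuous_pi fun i =>
    (continuous_of_discreteTopology (f := fun a : ZMod (odProd S (blockIndex n i)) =>
      blockCell (n (blockIndex n i)) a.val (i - wallPos n (blockIndex n i)))).comp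
      (continuous_odometerSpace_apply S (blockIndex n i))
  have hinj : Function.Injective f := fun z z' h => by
    have hzz' := gliderConfig_injOn n (hphase z) (hphase z') h
    exact Subtype.ext (funext fun k => ZMod.val_injective _ (congrFun hzz' k))
  have hstep (z : OdometerSpace S) : f (odometerAddOne S z) = gliderStep (f z) := by
    refine (gliderStep_gliderConfig (hphase z) fun k => ?_).symm
    have hlt : 1 < odProd S k := by have := hn k; have := (hne k).out; omega
    have hval : phase (odometerAddOne S z) k = ((z.1 k).val + 1) % odProd S k := by
      have : Fact (1 < odProd S k) := ⟨hlt⟩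
      simp only [phase, odometerAddOne, ZMod.val_add, ZMod.val_one]
    rw [hval, hn]
    have hz := ZMod.val_lt (z.1 k)
    split_ifs with h
    · rw [show (z.1 k).val + 1 = odProd S k from h, Nat.mod_self]
    · exact Nat.mod_eq_of_lt (lt_of_le_of_ne hz h)
  have hemb := hcont.isClosedEmbedding hinj
  refine ⟨Set.range f, ?_, hemb.isClosed_range, ?_, hemb.isEmbedding.toHomeomorph, hstep⟩
  · rintro _ ⟨z, rfl⟩
    exact gliderConfig_mem_XGlider (hphase z)
  · rintro _ ⟨z, rfl⟩
    exact ⟨odometerAddOne S z, hstep z⟩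
end

section
/- Let p be prime, let x ∈ (ℤ/pℤ)^ℤ, and suppose that column i of the space-time diagram of T_p with seed x is periodic with least period m. If Σ_{j=0}^{m−1} [T_p^j(x)]_i ≡ 0 (mod p), then column i−1 is periodic with least period m; if Σ_{j=0}^{m−1} [T_p^j(x)]_i ≢ 0 (mod p), then column i−1 is periodic with least period p·m. -/
/-- The two-sided cellular automaton `T_n` on `(ℤ/nℤ)^ℤ` with local rule
`xᵢ ↦ xᵢ + xᵢ₊₁ (mod n)`. -/
def Tca (n : ℕ) (x : ℤ → ZMod n) : ℤ → ZMod n := fun i => x i + x (i + 1)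

/-- Column `i` of the space-time diagram of `T_n` with seed `x`:
`j ↦ [T_n^j(x)]_i`. -/
def col (n : ℕ) (x : ℤ → ZMod n) (i : ℤ) : ℕ → ZMod n := fun j => (Tca n)^[j] x i

/-- A sequence `f : ℕ → α` is periodic with least period `m`. -/
def HasLeastPeriod {α : Type*} (f : ℕ → α) (m : ℕ) : Prop :=
  0 < m ∧ (∀ j, f (j + m) = f j) ∧ ∀ m', 0 < m' → (∀ j, f (j + m') = f j) → m ≤ m'

/-- The least period of a sequence divides each of its periods. -/
theorem HasLeastPeriod.dvd {α : Type*} {f : ℕ → α} {m q : ℕ} (h : HasLeastPeriod f m)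
    (hq : ∀ j, f (j + q) = f j) : m ∣ q := by
  obtain ⟨hm, hper, hmin⟩ := h
  have hmod : ∀ j, f (j + q % m) = f j := fun j => by
    have hmul : Function.Periodic f (q / m * m) := by
      simpa using Function.Periodic.nat_mul (show Function.Periodic f m from hper) (q / m)
    rw [← hmul, add_assoc, Nat.mod_add_div', hq]
  by_contra hdvd
  have hpos : 0 < q % m := Nat.pos_of_ne_zero fun h0 => hdvd (Nat.dvd_of_mod_eq_zero h0)
  exact absurd (hmin _ hpos hmod) (not_le.mpr (Nat.mod_lt q hm))

theorem col_sub_one_succ (n : ℕ) (x : ℤ → ZMod n) (i : ℤ) (j : ℕ) :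
    col n x (i - 1) (j + 1) = col n x (i - 1) j + col n x i j := by
  simp [col, Function.iterate_succ_apply', Tca]

section Antidifference

variable {G : Type*} [AddCommGroup G] {f g : ℕ → G} {m : ℕ}

/-- If `g` has difference sequence `f` of period `m`, shifting `g` by `k * m` adds `k` times the
sum of `f` over a period. -/
theorem antidifference_add_mul (hg : ∀ j, g (j + 1) = g j + f j) (hf : ∀ j, f (j + m) = f j)
    (k j : ℕ) : g (j + k * m) = g j + k • ∑ l ∈ Finset.range m, f l := by
  have hsum : ∀ k, g k = g 0 + ∑ l ∈ Finset.range k, f l := fun k => by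
    induction k with
    | zero => simp
    | succ k ih => rw [hg, ih, Finset.sum_range_succ, add_assoc]
  have hshift : ∀ j, g (j + m) = g j + ∑ l ∈ Finset.range m, f l := fun j => by
    induction j with
    | zero => rw [zero_add, hsum]
    | succ j ih => rw [add_right_comm, hg, ih, hf, hg, add_right_comm]
  induction k with
  | zero => simp
  | succ k ih => rw [add_mul, one_mul, ← add_assoc, hshift, ih, succ_nsmul, add_assoc]

/-- A sequence whose difference sequence has least period `m` has least period `r * m`, where `r`
is the additive order of the sum of the differences over a period, if that order is finite. -/
theorem HasLeastPeriod.antidifference (hg : ∀ j, g (j + 1) = g j + f j)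
    (h : HasLeastPeriod f m) (hr : 0 < addOrderOf (∑ l ∈ Finset.range m, f l)) :
    HasLeastPeriod g (addOrderOf (∑ l ∈ Finset.range m, f l) * m) := by
  refine ⟨Nat.mul_pos hr h.1, fun j => ?_, fun q hq hper => Nat.le_of_dvd hq ?_⟩
  · rw [antidifference_add_mul hg h.2.1, addOrderOf_nsmul_eq_zero, add_zero]
  · have hfq : ∀ j, f (j + q) = f j := fun j => by
      have hj := hper (j + 1)
      rw [add_right_comm, hg, hg, hper] at hj
      exact add_left_cancel hj
    obtain ⟨k, rfl⟩ := h.dvd hfq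
    have h0 := hper 0
    rw [mul_comm m k, antidifference_add_mul hg h.2.1, add_eq_left] at h0
    rw [mul_comm m k]
    exact mul_dvd_mul_right (addOrderOf_dvd_of_nsmul_eq_zero h0) m

end Antidifference

/-- For `p` prime: if column `i` has least period `m`, then column `i - 1` has
least period `m` when `Σ_{j<m} [T_p^j(x)]_i ≡ 0 (mod p)`, and least period
`p * m` otherwise. -/
theorem column_left_least_period_prime (p : ℕ) (hp : p.Prime) (x : ℤ → ZMod p)
    (i : ℤ) (m : ℕ) (h : HasLeastPeriod (col p x i) m) :
    ((∑ j ∈ Finset.range m, col p x i j) = 0 →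
        HasLeastPeriod (col p x (i - 1)) m) ∧
    ((∑ j ∈ Finset.range m, col p x i j) ≠ 0 →
        HasLeastPeriod (col p x (i - 1)) (p * m)) := by
  have key := h.antidifference (col_sub_one_succ p x i)
  refine ⟨fun hS => ?_, fun hS => ?_⟩
  · simpa [hS] using key
  · have : Fact p.Prime := ⟨hp⟩
    have hord := addOrderOf_eq_prime (p := p) (by simp) hS
    rw [hord] at key
    exact key hp.pos
end

section
/- Let p be prime and let m ≥ 2 be an integer not divisible by p. Then the odometer ((ℤ/mℤ) × ℤ_p, (a,z) ↦ (a+1, z+1)) — which is (topologically conjugate to) the S-adic odometer with S = (m, p, p, p, …) — can be embedded in the two-sided cellular automaton ((ℤ/pℤ)^ℤ, T_p). -/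
/-- The `k`-th binomial coefficient of a `p`-adic integer, reduced modulo `p`. -/
noncomputable def chooseMod (p : ℕ) [Fact p.Prime] (z : ℤ_[p]) (k : ℕ) : ZMod p :=
  PadicInt.toZMod (Ring.choose z k)

section ChooseMod

variable {p : ℕ} [Fact p.Prime]

theorem PadicInt.continuous_toZMod : Continuous (PadicInt.toZMod : ℤ_[p] →+* ZMod p) := by
  refine IsLocallyConstant.continuous ((IsLocallyConstant.iff_exists_open _).2 fun x => ?_)
  refine ⟨Metric.ball x 1, Metric.isOpen_ball, Metric.mem_ball_self one_pos, fun y hy => ?_⟩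
  rw [← sub_eq_zero, ← map_sub, ← RingHom.mem_ker, PadicInt.ker_toZMod,
    PadicInt.maximalIdeal_eq_span_p, Ideal.mem_span_singleton, ← PadicInt.norm_lt_one_iff_dvd,
    ← dist_eq_norm]
  exact hy

theorem continuous_chooseMod (k : ℕ) : Continuous fun z : ℤ_[p] => chooseMod p z k :=
  PadicInt.continuous_toZMod.comp (PadicInt.continuous_choose k)

theorem chooseMod_zero_right (z : ℤ_[p]) : chooseMod p z 0 = 1 := by
  simp [chooseMod]

theorem chooseMod_add_one_succ (z : ℤ_[p]) (k : ℕ) :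
    chooseMod p (z + 1) (k + 1) = chooseMod p z k + chooseMod p z (k + 1) := by
  simp [chooseMod, Ring.choose_succ_succ]

theorem chooseMod_natCast (n k : ℕ) : chooseMod p (n : ℤ_[p]) k = n.choose k := by
  simp [chooseMod, Ring.choose_natCast]

theorem chooseMod_add (z w : ℤ_[p]) (k : ℕ) :
    chooseMod p (z + w) k =
      ∑ ij ∈ Finset.HasAntidiagonal.antidiagonal k, chooseMod p z ij.1 * chooseMod p w ij.2 := by
  simp [chooseMod, Ring.add_choose_eq k (Commute.all z w)]

theorem chooseMod_add_congr {z w : ℤ_[p]} (h : chooseMod p z = chooseMod p w) (t : ℤ_[p]) :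
    chooseMod p (z + t) = chooseMod p (w + t) := by
  ext k
  rw [chooseMod_add, chooseMod_add, h]

theorem chooseMod_mul_eq_of_eq {s : ℤ_[p]} (h : chooseMod p s = chooseMod p 0) (t : ℤ_[p]) :
    chooseMod p (t * s) = chooseMod p 0 := by
  refine PadicInt.denseRange_natCast.induction_on t ?_ fun n => ?_
  · refine isClosed_eq (continuous_pi fun k => ?_) continuous_const
    exact (continuous_chooseMod k).comp (continuous_mul_const s)
  · induction n with
    | zero => simp
    | succ n ih =>
      rw [Nat.cast_succ, add_one_mul, chooseMod_add_congr ih, zero_add, h]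

theorem chooseMod_injective : Function.Injective (chooseMod p) := by
  intro z w h
  by_contra hne
  have hs : z - w ≠ 0 := sub_ne_zero.2 hne
  have h0 : chooseMod p (z - w) = chooseMod p 0 := by
    simpa [sub_eq_add_neg] using chooseMod_add_congr h (-w)
  have h1 := chooseMod_mul_eq_of_eq h0 (↑(PadicInt.unitCoeff hs)⁻¹)
  have hpow : ↑(PadicInt.unitCoeff hs)⁻¹ * (z - w) = ((p ^ (z - w).valuation : ℕ) : ℤ_[p]) := by
    rw [Units.inv_mul_eq_iff_eq_mul, Nat.cast_pow]
    exact PadicInt.unitCoeff_spec hs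
  rw [hpow, ← Nat.cast_zero] at h1
  have h2 := congrFun h1 (p ^ (z - w).valuation)
  rw [chooseMod_natCast, chooseMod_natCast, Nat.choose_self,
    Nat.choose_eq_zero_of_lt (pow_pos (Fact.out : p.Prime).pos _)] at h2
  simp at h2

end ChooseMod

/-- A linear functional that is nonzero at `1` separates the points of `F[b]` by its values
on `b, b², b³, …`. -/
theorem eq_zero_of_forall_apply_mul_pow_succ {F K : Type*} [Field F] [Field K] [Algebra F K]
    [Algebra.IsAlgebraic F K] {l : K →ₗ[F] F} (hl : l 1 ≠ 0) {b c : K} (hb : b ≠ 0)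
    (hc : c ∈ Algebra.adjoin F {b}) (h : ∀ k : ℕ, l (c * b ^ (k + 1)) = 0) : c = 0 := by
  by_contra hc0
  have key : ∀ d ∈ Algebra.adjoin F {b}, l (c * b * d) = 0 := by
    intro d hd
    rw [Algebra.adjoin_singleton_eq_range_aeval] at hd
    obtain ⟨q, rfl⟩ := hd
    change l (c * b * Polynomial.aeval b q) = 0
    rw [Polynomial.aeval_eq_sum_range, Finset.mul_sum, map_sum]
    refine Finset.sum_eq_zero fun k _ => ?_
    rw [mul_smul_comm, map_smul, mul_assoc, ← pow_succ', h, smul_zero]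
  refine hl ?_
  rw [← mul_inv_cancel₀ (mul_ne_zero hc0 hb)]
  have hcb : c * b ∈ Algebra.adjoin F {b} :=
    mul_mem hc (Algebra.self_mem_adjoin_singleton F b)
  exact key _ (Subalgebra.inv_mem_of_algebraic _ (x := (⟨c * b, hcb⟩ : Algebra.adjoin F {b}))
    (Algebra.IsAlgebraic.isAlgebraic _))

theorem IsPrimitiveRoot.pow_val_add_one {K : Type*} [CommMonoid K] {m : ℕ} [NeZero m] {ζ : K}
    (hζ : IsPrimitiveRoot ζ m) (a : ZMod m) : ζ ^ (a + 1).val = ζ ^ a.val * ζ := by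
  rw [← pow_succ, ZMod.val_add, ZMod.val_one_eq_one_mod, Nat.add_mod_mod]
  conv_rhs => rw [← pow_mod_orderOf, ← hζ.eq_orderOf]

/-- A `T_p`-periodic configuration of period `m` built from a linear functional `l` and a primitive
`m`-th root of unity `ζ`, plus the configuration of binomial coefficients modulo `p`
on the nonpositive indices. -/
noncomputable def odometerCode {p : ℕ} [Fact p.Prime] {m : ℕ} {K : Type*} [Field K]
    [Algebra (ZMod p) K] (l : K →ₗ[ZMod p] ZMod p) (ζ : K) (x : ZMod m × ℤ_[p]) (i : ℤ) : ZMod p :=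
  l (ζ ^ x.1.val * (ζ - 1) ^ i) + if i ≤ 0 then chooseMod p x.2 i.natAbs else 0

section OdometerCode

variable {p : ℕ} [Fact p.Prime] {m : ℕ} {K : Type*} [Field K] [Algebra (ZMod p) K]
  {l : K →ₗ[ZMod p] ZMod p} {ζ : K}

theorem continuous_odometerCode [NeZero m] :
    Continuous (odometerCode (p := p) (m := m) l ζ) := by
  refine continuous_pi fun i => continuous_prod_of_discrete_left.2 fun a => ?_
  refine (continuous_const (y := l (ζ ^ a.val * (ζ - 1) ^ i))).add ?_
  split_ifs
  · exact continuous_chooseMod _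
  · exact continuous_const

theorem odometerCode_add_one [NeZero m] (hζ : IsPrimitiveRoot ζ m) (hζ1 : ζ ≠ 1)
    (a : ZMod m) (z : ℤ_[p]) :
    odometerCode l ζ (a + 1, z + 1) = Tca p (odometerCode l ζ (a, z)) := by
  have hb : ζ - 1 ≠ 0 := sub_ne_zero.2 hζ1
  ext i
  have hper : l (ζ ^ (a + 1).val * (ζ - 1) ^ i) =
      l (ζ ^ a.val * (ζ - 1) ^ i) + l (ζ ^ a.val * (ζ - 1) ^ (i + 1)) := by
    rw [← map_add, hζ.pow_val_add_one, zpow_add_one₀ hb]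
    congr 1
    ring
  have hbin : (if i ≤ 0 then chooseMod p (z + 1) i.natAbs else 0) =
      (if i ≤ 0 then chooseMod p z i.natAbs else 0) +
        if i + 1 ≤ 0 then chooseMod p z (i + 1).natAbs else 0 := by
    rcases lt_trichotomy i 0 with hi | rfl | hi
    · obtain ⟨k, rfl⟩ : ∃ k : ℕ, i = -((k : ℤ) + 1) := ⟨(-i - 1).toNat, by omega⟩
      rw [if_pos (by omega), if_pos (by omega), if_pos (by omega),
        show (-((k : ℤ) + 1)).natAbs = k + 1 by omega,
        show (-((k : ℤ) + 1) + 1).natAbs = k by omega, chooseMod_add_one_succ, add_comm]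
    · simp [chooseMod_zero_right]
    · rw [if_neg (by omega), if_neg (by omega), if_neg (by omega), add_zero]
  simp only [odometerCode, Tca, hper, hbin]
  ring

theorem odometerCode_injective [NeZero m] [Algebra.IsAlgebraic (ZMod p) K]
    (hζ : IsPrimitiveRoot ζ m) (hζ1 : ζ ≠ 1) (hl : l 1 ≠ 0) :
    Function.Injective (odometerCode (m := m) l ζ) := by
  rintro ⟨a, z⟩ ⟨b, w⟩ h
  have hmem : ζ ∈ Algebra.adjoin (ZMod p) {ζ - 1} := by
    simpa using add_mem (Algebra.self_mem_adjoin_singleton (ZMod p) (ζ - 1)) (one_mem _)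
  have hpow : ζ ^ a.val - ζ ^ b.val = 0 := by
    refine eq_zero_of_forall_apply_mul_pow_succ hl (sub_ne_zero.2 hζ1)
      (sub_mem (pow_mem hmem _) (pow_mem hmem _)) fun k => ?_
    have hk := congrFun h ((k + 1 : ℕ) : ℤ)
    simp only [odometerCode, zpow_natCast] at hk
    rw [if_neg (by omega), if_neg (by omega), add_zero, add_zero] at hk
    rw [sub_mul, map_sub, hk, sub_self]
  obtain rfl : a = b := ZMod.val_injective m
    (hζ.pow_inj (ZMod.val_lt a) (ZMod.val_lt b) (sub_eq_zero.1 hpow))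
  refine Prod.ext rfl (chooseMod_injective (funext fun k => ?_))
  simpa [odometerCode] using congrFun h (-(k : ℤ))

end OdometerCode

/-- For `p` prime and `m ≥ 2` not divisible by `p`, the odometer
`((ℤ/mℤ) × ℤ_p, (a, z) ↦ (a + 1, z + 1))` can be embedded in the two-sided
cellular automaton `((ℤ/pℤ)^ℤ, T_p)`. -/
theorem mixed_odometer_embeds (p : ℕ) [Fact p.Prime] (m : ℕ) (hm : 2 ≤ m)
    (hpm : ¬ p ∣ m) :
    ∃ Y : Set (ℤ → ZMod p), IsClosed Y ∧ Set.MapsTo (Tca p) Y Y ∧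
      ∃ h : (ZMod m × ℤ_[p]) ≃ₜ Y,
        ∀ (a : ZMod m) (z : ℤ_[p]),
          (h (a + 1, z + 1) : ℤ → ZMod p) = Tca p (h (a, z)) := by
  have : NeZero m := ⟨by omega⟩
  have : NeZero (m : ZMod p) := ⟨by rwa [Ne, ZMod.natCast_eq_zero_iff]⟩
  obtain ⟨ζ, hζ⟩ := HasEnoughRootsOfUnity.exists_primitiveRoot (AlgebraicClosure (ZMod p)) m
  have hζ1 : ζ ≠ 1 := hζ.ne_one (by omega)
  obtain ⟨l, hl⟩ : ∃ l : AlgebraicClosure (ZMod p) →ₗ[ZMod p] ZMod p, l 1 ≠ 0 := by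
    by_contra! h
    exact one_ne_zero ((Module.forall_dual_apply_eq_zero_iff (ZMod p) _).1 h)
  have hemb : Topology.IsClosedEmbedding (odometerCode (m := m) l ζ) :=
    continuous_odometerCode.isClosedEmbedding (odometerCode_injective hζ hζ1 hl)
  refine ⟨Set.range (odometerCode l ζ), hemb.isClosed_range, ?_,
    hemb.isEmbedding.toHomeomorph, odometerCode_add_one hζ hζ1⟩
  rintro _ ⟨⟨a, z⟩, rfl⟩
  exact ⟨(a + 1, z + 1), odometerCode_add_one hζ hζ1 a z⟩
end
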